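/- arXiv:1909.11225 — 2 statements merged into one kernel-verified Lean document; each statement's English description precedes it below -/
import Mathlib

section
/- Let n ≥ 19, k ≥ 3. For G drawn from the unconditioned permutation model R*(n,2k) and any integer c ≥ 1, Pr[C(G) = c] ≤ (1.5^(c−1)/c!)·(e/n)^((k−1)(c−1)), where C(G) is the number of connected components of G. -/
open scoped Classical

/-- Number of connected components of the multigraph from `R*(n, 2k)` generated by `π`. -/
noncomputable def numComponents {n : ℕ} (k : ℕ) (π : Fin k → Equiv.Perm (Fin n)) : ℕ :=
  Nat.card (Quot (fun a b : Fin n => ∃ i, π i a = b))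

/-- Correction constants. -/
def KK (D : ℕ) : ℕ := if D = 0 then 1 else if D = 1 then 2 else if D = 2 then 4 else 5

lemma KK_le (D : ℕ) : KK D ≤ 5 := by unfold KK; split_ifs <;> omega

lemma one_le_KK (D : ℕ) : 1 ≤ KK D := by unfold KK; split_ifs <;> omega

lemma fact_mul_le (i j : ℕ) (hi : 1 ≤ i) (hj : 1 ≤ j) :
    (i+1).factorial * (j+1).factorial ≤ 2 * (i+j).factorial := by
  induction j, hj using Nat.le_induction with
  | base => simp [Nat.factorial, mul_comm]
  | succ j hj ih =>
    rw [Nat.factorial_succ (j+1), ← add_assoc, Nat.factorial_succ (i+j)]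
    have h : j + 1 + 1 ≤ i + j + 1 := by omega
    calc _ = (j+1+1) * ((i+1).factorial * (j+1).factorial) := by ring
      _ ≤ (i+j+1) * (2 * (i+j).factorial) := Nat.mul_le_mul h ih
      _ = _ := by ring

lemma fact_mul_le' (i j : ℕ) :
    (i+1).factorial * (j+1).factorial ≤ (i+j+1).factorial := by
  rcases Nat.eq_zero_or_pos i with rfl | hi
  · simp
  rcases Nat.eq_zero_or_pos j with rfl | hj
  · simp
  refine (fact_mul_le i j hi hj).trans ?_
  rw [Nat.factorial_succ]
  exact Nat.mul_le_mul_right _ (by omega)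

lemma base_sum (D : ℕ) :
    2 * ∑ p ∈ Finset.HasAntidiagonal.antidiagonal D, ((p.1+1).factorial * (p.2+1).factorial)^2 * KK p.2
      ≤ 3 * KK D * (D+1).factorial ^ 2 := by
  rw [Finset.Nat.sum_antidiagonal_eq_sum_range_succ_mk]
  rcases Nat.lt_or_ge D 10 with h | h
  · interval_cases D <;> norm_num [Finset.sum_range_succ, KK, Nat.factorial]
  · obtain ⟨E, rfl⟩ : ∃ E, D = E + 1 := ⟨D - 1, by omega⟩
    rw [Finset.sum_range_succ, Finset.sum_range_succ']
    have hK : KK (E+1) = 5 := by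
      unfold KK
      rw [if_neg (by omega), if_neg (by omega), if_neg (by omega)]
    have hK0 : KK 0 = 1 := rfl
    simp only [Nat.sub_zero, Nat.sub_self, hK, hK0]
    set X := (E+1+1).factorial ^ 2 with hX
    have hs : (E+2)^2 * ∑ i ∈ Finset.range E, ((i+1+1).factorial * (E+1-(i+1)+1).factorial)^2
        * KK (E+1-(i+1)) ≤ E * (20 * X) := by
      rw [Finset.mul_sum]
      refine (Finset.sum_le_card_nsmul _ _ (20 * X) ?_).trans (by simp)
      intro i hi
      rw [Finset.mem_range] at hi
      have h1 := fact_mul_le (i+1) (E+1-(i+1)) (by omega) (by omega)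
      have h2 : i + 1 + (E+1-(i+1)) = E+1 := by omega
      rw [h2] at h1
      calc _ ≤ (E+2)^2 * ((2 * (E+1).factorial)^2 * 5) :=
            Nat.mul_le_mul_left _ (Nat.mul_le_mul (Nat.pow_le_pow_left h1 2) (KK_le _))
        _ = _ := by rw [hX, Nat.factorial_succ (E+1)]; ring
    set S := ∑ i ∈ Finset.range E, ((i+1+1).factorial * (E+1-(i+1)+1).factorial)^2
        * KK (E+1-(i+1))
    have hS : 2 * S ≤ 3 * X := by
      have h3 : 40 * E ≤ 3 * (E+2)^2 := by nlinarith
      have h4 : (E+2)^2 * (2 * S) ≤ (E+2)^2 * (3 * X) := by nlinarith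
      exact Nat.le_of_mul_le_mul_left h4 (by positivity)
    simp only [zero_add, Nat.factorial_one, one_mul, mul_one]
    rw [← hX]
    omega

/-- Generating function of factorial powers. -/
noncomputable def phi (m : ℕ) : PowerSeries ℕ := PowerSeries.mk (fun d => (d+1).factorial ^ m)

lemma coeff_bound (m c D : ℕ) (hm : 2 ≤ m) :
    2 ^ c * PowerSeries.coeff D (phi m ^ (c+1)) ≤ 3 ^ c * (KK D * (D+1).factorial ^ m) := by
  induction c generalizing D with
  | zero =>
    simp only [pow_zero, one_mul, zero_add, pow_one, phi, PowerSeries.coeff_mk]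
    exact Nat.le_mul_of_pos_left _ (one_le_KK D)
  | succ c ih =>
    obtain ⟨l, rfl⟩ : ∃ l, m = l + 2 := ⟨m - 2, by omega⟩
    rw [pow_succ' (phi (l+2)), PowerSeries.coeff_mul, pow_succ, pow_succ]
    have key : ∀ p ∈ Finset.HasAntidiagonal.antidiagonal D,
        2 ^ c * (PowerSeries.coeff p.1 (phi (l+2)) * PowerSeries.coeff p.2 (phi (l+2) ^ (c+1)))
        ≤ 3 ^ c * (D+1).factorial ^ l *
          (((p.1+1).factorial * (p.2+1).factorial)^2 * KK p.2) := by
      rintro ⟨i, j⟩ hp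
      rw [Finset.HasAntidiagonal.mem_antidiagonal] at hp
      simp only at hp ⊢
      have h1 := fact_mul_le' i j
      rw [hp] at h1
      have h2 := Nat.pow_le_pow_left h1 l
      have h3 := ih j
      simp only [phi, PowerSeries.coeff_mk] at h3 ⊢
      calc _ = (i+1).factorial ^ (l+2) * (2 ^ c * PowerSeries.coeff j
              (PowerSeries.mk (fun d => (d+1).factorial ^ (l+2)) ^ (c+1))) := by ring
        _ ≤ (i+1).factorial ^ (l+2) * (3 ^ c * (KK j * (j+1).factorial ^ (l+2))) :=
            Nat.mul_le_mul_left _ h3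
        _ = 3 ^ c * ((i+1).factorial * (j+1).factorial) ^ l *
          (((i+1).factorial * (j+1).factorial)^2 * KK j) := by ring
        _ ≤ _ := by gcongr
    calc _ = 2 * ∑ p ∈ Finset.HasAntidiagonal.antidiagonal D, 2 ^ c *
          (PowerSeries.coeff p.1 (phi (l+2)) * PowerSeries.coeff p.2 (phi (l+2) ^ (c+1))) := by
          rw [← Finset.mul_sum]; ring
      _ ≤ 2 * ∑ p ∈ Finset.HasAntidiagonal.antidiagonal D, 3 ^ c * (D+1).factorial ^ l *
          (((p.1+1).factorial * (p.2+1).factorial)^2 * KK p.2) :=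
          Nat.mul_le_mul_left _ (Finset.sum_le_sum key)
      _ = 3 ^ c * (D+1).factorial ^ l * (2 * ∑ p ∈ Finset.HasAntidiagonal.antidiagonal D,
          (((p.1+1).factorial * (p.2+1).factorial)^2 * KK p.2)) := by
          rw [← Finset.mul_sum]; ring
      _ ≤ 3 ^ c * (D+1).factorial ^ l * (3 * KK D * (D+1).factorial ^ 2) :=
          Nat.mul_le_mul_left _ (base_sum D)
      _ = _ := by ring

/-- Product of the factorials of the fibre sizes. -/
noncomputable def PP {n c : ℕ} (f : Fin n → Fin c) : ℕ :=
  ∏ b, (Fintype.card {a // f a = b}).factorial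

lemma card_stab {n c : ℕ} (f : Fin n → Fin c) :
    (Finset.univ.filter (fun g : Equiv.Perm (Fin n) => f ∘ g = f)).card = PP f := by
  unfold PP
  rw [← DomMulAct.stabilizer_card f, Fintype.card_subtype]

lemma count_pairs (n k c : ℕ) :
    c.factorial * (Finset.univ.filter
        (fun π : Fin k → Equiv.Perm (Fin n) => numComponents k π = c)).card
      ≤ ∑ f ∈ Finset.univ.filter (fun f : Fin n → Fin c => Function.Surjective f),
          PP f ^ k := by
  set A := Finset.univ.filter
        (fun π : Fin k → Equiv.Perm (Fin n) => numComponents k π = c) with hA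
  set B := Finset.univ.filter (fun f : Fin n → Fin c => Function.Surjective f) with hB
  let r : (Fin k → Equiv.Perm (Fin n)) → (Fin n → Fin c) → Prop := fun π f => ∀ i, f ∘ π i = f
  have h1 : ∀ π ∈ A, c.factorial ≤ (B.bipartiteAbove r π).card := by
    intro π hπ
    rw [hA, Finset.mem_filter] at hπ
    have hq := hπ.2
    unfold numComponents at hq
    set Q := Quot (fun a b : Fin n => ∃ i, π i a = b) with hQ
    have : Finite Q := by rw [hQ]; infer_instance
    have : Fintype Q := Fintype.ofFinite Q
    rw [Nat.card_eq_fintype_card] at hq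
    have e0 : Q ≃ Fin c := Fintype.equivFinOfCardEq hq
    have hc : Fintype.card (Q ≃ Fin c) = c.factorial := by
      rw [Fintype.card_equiv e0, hq]
    rw [← hc, ← Finset.card_univ]
    refine Finset.card_le_card_of_injOn (fun e : Q ≃ Fin c => fun a => e (Quot.mk _ a)) ?_ ?_
    · intro e _
      simp only [Finset.coe_bipartiteAbove, hB, Finset.mem_filter, Finset.mem_univ, true_and,
        Set.mem_ofPred_eq]
      refine ⟨fun b => ?_, fun i => ?_⟩
      · obtain ⟨a, ha⟩ := Quot.exists_rep (e.symm b)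
        exact ⟨a, by simp [ha]⟩
      · funext a
        simp only [Function.comp]
        congr 1
        exact (Quot.sound ⟨i, rfl⟩).symm
    · intro e _ e' _ h
      ext x
      obtain ⟨a, rfl⟩ := Quot.exists_rep x
      exact congrArg Fin.val (congrFun h a)
  have h2 : ∀ f ∈ B, (A.bipartiteBelow r f).card ≤ PP f ^ k := by
    intro f _
    rw [← card_stab f]
    have := Fintype.card_piFinset_const
      (Finset.univ.filter (fun g : Equiv.Perm (Fin n) => f ∘ g = f)) k
    rw [← this]
    apply Finset.card_le_card
    intro π hπ
    rw [Finset.mem_bipartiteBelow] at hπ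
    rw [Fintype.mem_piFinset]
    intro i
    simpa using hπ.2 i
  calc _ = ∑ π ∈ A, c.factorial := by simp [mul_comm]
    _ ≤ ∑ π ∈ A, (B.bipartiteAbove r π).card := Finset.sum_le_sum h1
    _ = ∑ f ∈ B, (A.bipartiteBelow r f).card :=
        Finset.sum_card_bipartiteAbove_eq_sum_card_bipartiteBelow r
    _ ≤ _ := Finset.sum_le_sum h2

lemma fiber_count {n c : ℕ} (f0 : Fin n → Fin c) (S : Finset (Fin n → Fin c))
    (hS : ∀ f ∈ S, ∀ b, Fintype.card {a // f a = b} = Fintype.card {a // f0 a = b}) :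
    S.card * PP f0 ≤ n.factorial := by
  have hex : ∀ f ∈ S, ∃ τ : Equiv.Perm (Fin n), f0 ∘ τ = f := by
    intro f hf
    have e : ∀ b, {a // f a = b} ≃ {a // f0 a = b} := fun b => Fintype.equivOfCardEq (hS f hf b)
    exact ⟨Equiv.ofFiberEquiv e, funext fun a => Equiv.ofFiberEquiv_map e a⟩
  choose! τ hτ using hex
  have hn : n.factorial = (Finset.univ : Finset (Equiv.Perm (Fin n))).card := by
    rw [Finset.card_univ, Fintype.card_perm, Fintype.card_fin]
  rw [← card_stab f0, ← Finset.card_product, hn]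
  refine Finset.card_le_card_of_injOn (fun p => (τ p.1).trans p.2) (by intro x _; simp) ?_
  rintro ⟨f, g⟩ hp ⟨f', g'⟩ hp' h
  simp only [Finset.coe_product, Set.mem_prod, Finset.mem_coe, Finset.mem_filter,
    Finset.mem_univ, true_and] at hp hp'
  simp only at h
  have hf : f = f0 ∘ ((τ f).trans g) := by
    rw [Equiv.coe_trans, ← Function.comp_assoc, hp.2, hτ f hp.1]
  have hf' : f' = f0 ∘ ((τ f').trans g') := by
    rw [Equiv.coe_trans, ← Function.comp_assoc, hp'.2, hτ f' hp'.1]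
  have hff : f = f' := by rw [hf, h, ← hf']
  subst hff
  have hg : g = g' := by
    ext x
    have := congrArg (fun e : Equiv.Perm (Fin n) => e ((τ f).symm x)) h
    simpa using congrArg Fin.val this
  rw [hg]

lemma sum_PP (n c m : ℕ) :
    ∑ f ∈ Finset.univ.filter (fun f : Fin n → Fin c => Function.Surjective f), PP f ^ (m+1)
      ≤ n.factorial * PowerSeries.coeff (n - c) (phi m ^ c) := by
  set B := Finset.univ.filter (fun f : Fin n → Fin c => Function.Surjective f) with hB
  let s : (Fin n → Fin c) → (Fin c →₀ ℕ) := fun f =>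
    Finsupp.equivFunOnFinite.symm (fun b => Fintype.card {a // f a = b} - 1)
  have hs : ∀ f b, s f b = Fintype.card {a // f a = b} - 1 := fun f b => rfl
  have hpos : ∀ f ∈ B, ∀ b, Fintype.card {a // f a = b} = s f b + 1 := by
    intro f hf b
    rw [hB, Finset.mem_filter] at hf
    obtain ⟨a, ha⟩ := hf.2 b
    have : 0 < Fintype.card {a // f a = b} := Fintype.card_pos_iff.mpr ⟨⟨a, ha⟩⟩
    rw [hs]; omega
  have hmap : ∀ f ∈ B, s f ∈ Finset.finsuppAntidiag (Finset.univ : Finset (Fin c)) (n - c) := by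
    intro f hf
    rw [Finset.mem_finsuppAntidiag]
    refine ⟨?_, Finset.subset_univ _⟩
    have h1 : ∑ b, Fintype.card {a // f a = b} = n := by
      rw [← Fintype.card_sigma, Fintype.card_congr (Equiv.sigmaFiberEquiv f), Fintype.card_fin]
    rw [Finset.sum_congr rfl (fun b _ => hpos f hf b), Finset.sum_add_distrib] at h1
    simp only [Finset.sum_const, Finset.card_univ, Fintype.card_fin, smul_eq_mul, mul_one] at h1
    change ∑ b, s f b = n - c
    omega
  have hphi : PowerSeries.coeff (n - c) (phi m ^ c) =
      ∑ l ∈ Finset.finsuppAntidiag (Finset.univ : Finset (Fin c)) (n - c),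
        ∏ b, (l b + 1).factorial ^ m := by
    have : phi m ^ c = ∏ _b : Fin c, phi m := by simp
    rw [this, PowerSeries.coeff_prod]
    simp [phi]
  rw [hphi, ← Finset.sum_fiberwise_of_maps_to hmap, Finset.mul_sum]
  refine Finset.sum_le_sum fun l _ => ?_
  set S := B.filter (fun f => s f = l) with hSdef
  have hPP : ∀ f ∈ S, PP f = ∏ b, (l b + 1).factorial := by
    intro f hf
    rw [hSdef, Finset.mem_filter] at hf
    unfold PP
    exact Finset.prod_congr rfl fun b _ => by rw [hpos f hf.1, hf.2]
  rw [Finset.sum_congr rfl (fun f hf => by rw [hPP f hf]), Finset.sum_const, smul_eq_mul,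
    Finset.prod_pow, pow_succ']
  rw [← mul_assoc]
  apply Nat.mul_le_mul_right
  rcases S.eq_empty_or_nonempty with h0 | ⟨f0, hf0⟩
  · simp [h0]
  · rw [← hPP f0 hf0]
    apply fiber_count
    intro f hf b
    rw [hSdef, Finset.mem_filter] at hf hf0
    rw [hpos f hf.1, hpos f0 hf0.1, hf.2, hf0.2]

/-- `e^t n(n-1)...(n-t+1) / n^t`. -/
noncomputable def hh (n t : ℕ) : ℝ := Real.exp 1 ^ t * (n.descFactorial t : ℝ) / (n:ℝ) ^ t

lemma hh_succ (n t : ℕ) (ht : t ≤ n) :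
    hh n (t+1) = hh n t * (Real.exp 1 * ((n:ℝ) - t) / n) := by
  unfold hh
  rw [Nat.descFactorial_succ]
  push_cast [Nat.cast_sub ht]
  rw [pow_succ, pow_succ, div_mul_div_comm]
  congr 1
  ring

lemma hh_nonneg (n t : ℕ) : 0 ≤ hh n t := by unfold hh; positivity

lemma hh_top (n : ℕ) (hn : 19 ≤ n) : 2.5 ≤ hh n n := by
  have h := Stirling.le_factorial_stirling n
  have hn' : (19:ℝ) ≤ n := by exact_mod_cast hn
  unfold hh
  rw [Nat.descFactorial_self]
  have h2 : (2.5:ℝ) ≤ √(2 * Real.pi * n) := by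
    apply Real.le_sqrt_of_sq_le
    nlinarith [Real.pi_gt_three]
  have hp : (0:ℝ) < (n:ℝ)^n := by positivity
  rw [le_div_iff₀ hp]
  rw [div_pow] at h
  have he : (0:ℝ) < Real.exp 1 ^ n := by positivity
  calc (2.5:ℝ) * n^n ≤ √(2 * Real.pi * n) * n^n := by gcongr
    _ = Real.exp 1 ^ n * (√(2 * Real.pi * n) * (n^n / Real.exp 1 ^ n)) := by field_simp
    _ ≤ _ := by gcongr

lemma hh_up (n t : ℕ) (hn : 19 ≤ n) (ht : t ≤ n) (h : (n:ℝ) ≤ Real.exp 1 * ((n:ℝ) - t)) :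
    2.5 ≤ hh n (t+1) := by
  have hn' : (19:ℝ) ≤ n := by exact_mod_cast hn
  induction t with
  | zero =>
    have : hh n 1 = Real.exp 1 := by
      unfold hh
      simp
      field_simp
    rw [zero_add, this]
    linarith [Real.exp_one_gt_d9]
  | succ t ih =>
    have he := Real.exp_pos 1
    have h1 := ih (by omega) (by push_cast at h; nlinarith)
    rw [hh_succ n (t+1) ht]
    have : 1 ≤ Real.exp 1 * ((n:ℝ) - (t+1:ℕ)) / n := by
      rw [le_div_iff₀ (by linarith)]; linarith
    nlinarith

lemma hh_down (n d t : ℕ) (hn : 19 ≤ n) (ht : t + d = n) (h : Real.exp 1 * ((n:ℝ) - t) ≤ n) :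
    2.5 ≤ hh n t := by
  have hn' : (19:ℝ) ≤ n := by exact_mod_cast hn
  induction d generalizing t with
  | zero =>
    have : t = n := by omega
    rw [this]; exact hh_top n hn
  | succ d ih =>
    have he := Real.exp_pos 1
    have h1 := ih (t+1) (by omega) (by push_cast; nlinarith)
    rw [hh_succ n t (by omega)] at h1
    have : Real.exp 1 * ((n:ℝ) - t) / n ≤ 1 := by
      rw [div_le_iff₀ (by linarith)]; linarith
    nlinarith [hh_nonneg n t]

lemma hh_ge (n t : ℕ) (hn : 19 ≤ n) (ht : t + 1 ≤ n) : 2.5 ≤ hh n (t+1) := by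
  rcases le_total (n:ℝ) (Real.exp 1 * ((n:ℝ) - t)) with h | h
  · exact hh_up n t hn (by omega) h
  · refine hh_down n (n - (t+1)) (t+1) hn (by omega) ?_
    push_cast
    nlinarith [Real.exp_pos 1]

/-- For `n ≥ 19`, `k ≥ 3` and any `c ≥ 1`, a graph `G` from `R*(n, 2k)` satisfies
`Pr[C(G) = c] ≤ (1.5^(c−1)/c!) · (e/n)^((k−1)(c−1))`. -/
theorem stmt14 (n k c : ℕ) (hn : 19 ≤ n) (hk : 3 ≤ k) (hc : 1 ≤ c) :
    ((Finset.univ.filter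
        (fun π : Fin k → Equiv.Perm (Fin n) => numComponents k π = c)).card : ℝ) /
      (Fintype.card (Fin k → Equiv.Perm (Fin n)) : ℝ)
    ≤ (1.5 : ℝ) ^ (c - 1) / (c.factorial : ℝ) *
        (Real.exp 1 / (n : ℝ)) ^ ((k - 1) * (c - 1)) := by
  have hn' : (19:ℝ) ≤ n := by exact_mod_cast hn
  have hcard : Fintype.card (Fin k → Equiv.Perm (Fin n)) = n.factorial ^ k := by
    simp [Fintype.card_perm]
  have h1 := count_pairs n k c
  obtain ⟨m, rfl⟩ : ∃ m, k = m + 1 := ⟨k - 1, by omega⟩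
  obtain ⟨t, rfl⟩ : ∃ t, c = t + 1 := ⟨c - 1, by omega⟩
  have hm : 2 ≤ m := by omega
  simp only [Nat.add_sub_cancel]
  set N := (Finset.univ.filter
        (fun π : Fin (m+1) → Equiv.Perm (Fin n) => numComponents (m+1) π = t + 1)).card with hN
  rw [hcard]
  rcases Nat.lt_or_ge n (t+1) with hlt | hge
  · have hB : Finset.univ.filter (fun f : Fin n → Fin (t+1) => Function.Surjective f) = ∅ := by
      rw [Finset.filter_eq_empty_iff]
      intro f _ hf
      have := Fintype.card_le_of_surjective f hf
      simp at this
      omega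
    rw [hB, Finset.sum_empty] at h1
    have hN0 : N = 0 := by
      have := Nat.factorial_pos (t+1)
      rcases Nat.eq_zero_or_pos N with h | h
      · exact h
      · have := Nat.mul_pos this h
        omega
    rw [hN0]
    simp only [Nat.cast_zero, zero_div]
    positivity
  rcases Nat.eq_zero_or_pos t with rfl | htpos
  · have : N ≤ n.factorial ^ (m+1) := by
      rw [← hcard, hN]; exact Finset.card_le_univ _
    simp only [pow_zero, mul_zero, zero_add, Nat.factorial_one, Nat.cast_one, div_one, mul_one]
    apply div_le_one_of_le₀
    · exact_mod_cast this
    · positivity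
  obtain ⟨u, rfl⟩ : ∃ u, t = u + 1 := ⟨t - 1, by omega⟩
  set t := u + 1 with ht
  have h2 := h1.trans (sum_PP n (t+1) m)
  have h3 := coeff_bound m t (n - (t+1)) hm
  have hD : n - (t+1) + 1 = n - t := by omega
  rw [hD] at h3
  have h4 : 2 ^ t * ((t+1).factorial * N) ≤ n.factorial * (3^t * (5 * (n-t).factorial ^ m)) := by
    calc _ ≤ 2 ^ t * (n.factorial * PowerSeries.coeff (n - (t+1)) (phi m ^ (t+1))) :=
          Nat.mul_le_mul_left _ h2
      _ = n.factorial * (2 ^ t * PowerSeries.coeff (n - (t+1)) (phi m ^ (t+1))) := by ring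
      _ ≤ n.factorial * (3 ^ t * (KK (n - (t+1)) * (n-t).factorial ^ m)) :=
          Nat.mul_le_mul_left _ h3
      _ ≤ _ := by gcongr; exact KK_le _
  have h4' : (2:ℝ) ^ t * (((t+1).factorial:ℝ) * N)
      ≤ n.factorial * (3^t * (5 * ((n-t).factorial:ℝ) ^ m)) := by exact_mod_cast h4
  have hh1 : 2.5 ≤ hh n t := hh_ge n u hn (by omega)
  have h5 : (5:ℝ) ≤ hh n t ^ m := by
    calc (5:ℝ) ≤ 2.5 ^ 2 := by norm_num
      _ ≤ hh n t ^ 2 := by gcongr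
      _ ≤ hh n t ^ m := pow_le_pow_right₀ (by linarith) hm
  have hdf : ((n-t).factorial : ℝ) * n.descFactorial t = n.factorial := by
    exact_mod_cast Nat.factorial_mul_descFactorial (by omega : t ≤ n)
  have hhe : ((n-t).factorial : ℝ) * hh n t = n.factorial * (Real.exp 1 / n) ^ t := by
    unfold hh
    rw [← hdf, div_pow]; ring
  have h6 : 5 * ((n-t).factorial:ℝ) ^ m ≤ (n.factorial:ℝ)^m * (Real.exp 1 / n) ^ (m * t) := by
    calc 5 * ((n-t).factorial:ℝ) ^ m ≤ hh n t ^ m * ((n-t).factorial:ℝ) ^ m := by gcongr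
      _ = (((n-t).factorial : ℝ) * hh n t) ^ m := by ring
      _ = _ := by rw [hhe, mul_pow, ← pow_mul, mul_comm t m]
  have hfn : (0:ℝ) < n.factorial := by exact_mod_cast Nat.factorial_pos n
  have hft : (0:ℝ) < (t+1).factorial := by exact_mod_cast Nat.factorial_pos _
  push_cast
  rw [div_le_iff₀ (by positivity)]
  have h7 : (2:ℝ) ^ t * (((t+1).factorial:ℝ) * N)
      ≤ n.factorial * (3^t * ((n.factorial:ℝ)^m * (Real.exp 1 / n) ^ (m * t))) :=
    h4'.trans (by gcongr)
  have h8 : (1.5:ℝ)^t = 3^t / 2^t := by rw [← div_pow]; norm_num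
  rw [h8]
  have h2p : (0:ℝ) < 2^t := by positivity
  have : (N:ℝ) = (2 ^ t * (((t+1).factorial:ℝ) * N)) / (2^t * (t+1).factorial) := by
    field_simp
  rw [this, div_le_iff₀ (by positivity)]
  refine h7.trans (le_of_eq ?_)
  field_simp
  rw [pow_succ']
end

section
/- Let n ≥ 19, k ≥ 3 and m ≤ (1/2)·(n/e)^(k−1). If G is drawn from R*(n,2k) then E[m^{C(G)}] ≤ m + m^2·(n/e)^(1−k). -/
open scoped Classical

lemma aux_fac (a b : ℕ) : (a+2).factorial * (b+2).factorial ≤ 2 * (a+b+2).factorial := by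
  induction b with
  | zero => simp [Nat.mul_comm]
  | succ b ih =>
    have h1 : (b+1+2).factorial = (b+3) * (b+2).factorial := Nat.factorial_succ (b+2)
    have h2 : (a+(b+1)+2).factorial = (a+b+3) * (a+b+2).factorial := Nat.factorial_succ (a+b+2)
    rw [h1, h2]
    calc _ = (b+3) * ((a+2).factorial * (b+2).factorial) := by ring
      _ ≤ (a+b+3) * (2 * (a+b+2).factorial) := Nat.mul_le_mul (by omega) ih
      _ = _ := by ring

lemma aux_U (p N : ℕ) (hp : 2 ≤ p) :
    ∑ i ∈ Finset.range N, (((i+1).factorial : ℝ) * ((N-i).factorial : ℝ))^p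
      ≤ 5/2 * ((N.factorial : ℝ))^p := by
  rcases N with _ | _ | M
  · norm_num
  · norm_num
  · rw [Finset.sum_range_succ, Finset.sum_range_succ']
    have hmid : ∀ i ∈ Finset.range M,
        (((i+1+1).factorial : ℝ) * ((M+1+1-(i+1)).factorial : ℝ))^p
          ≤ (2/((M:ℝ)+2))^2 * (((M+1+1).factorial : ℝ))^p := by
      intro i hi
      have hi' := Finset.mem_range.mp hi
      obtain ⟨b, rfl⟩ : ∃ b, M = i + b + 1 := ⟨M - i - 1, by omega⟩
      have e1 : i+b+1+1+1-(i+1) = b+2 := by omega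
      rw [e1]
      have h := aux_fac i b
      have h' : ((i+2).factorial : ℝ) * ((b+2).factorial : ℝ) ≤ 2 * ((i+b+2).factorial : ℝ) := by
        exact_mod_cast h
      have h3 : ((i+b+1+1+1).factorial : ℝ) = ((i:ℝ)+b+1+2) * ((i+b+2).factorial : ℝ) := by
        have := Nat.factorial_succ (i+b+2)
        rw [show i+b+1+1+1 = i+b+2+1 by ring, this]; push_cast; ring
      have hq : (0:ℝ) < (i:ℝ)+b+1+2 := by positivity
      have h4 : ((i+1+1).factorial : ℝ) * ((b+2).factorial : ℝ)
          ≤ 2/((i:ℝ)+b+1+2) * ((i+b+1+1+1).factorial : ℝ) := by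
        rw [h3]
        calc _ ≤ 2 * ((i+b+2).factorial : ℝ) := h'
          _ = _ := by field_simp
      push_cast
      calc _ ≤ (2/((i:ℝ)+b+1+2) * ((i+b+1+1+1).factorial : ℝ))^p := by gcongr
        _ = (2/((i:ℝ)+b+1+2))^p * ((i+b+1+1+1).factorial : ℝ)^p := mul_pow _ _ _
        _ ≤ _ := by
          apply mul_le_mul_of_nonneg_right _ (by positivity)
          apply pow_le_pow_of_le_one (by positivity) _ hp
          rw [div_le_one hq]
          have : (0:ℝ) ≤ i := by positivity
          have : (0:ℝ) ≤ b := by positivity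
          linarith
    have hs := Finset.sum_le_sum hmid
    rw [Finset.sum_const, Finset.card_range, nsmul_eq_mul, ← mul_assoc] at hs
    have hc : (M:ℝ) * (2/((M:ℝ)+2))^2 ≤ 1/2 := by
      rw [div_pow, mul_div_assoc', div_le_iff₀ (by positivity)]
      nlinarith [sq_nonneg ((M:ℝ)-2)]
    have hF : (0:ℝ) ≤ ((M+1+1).factorial : ℝ)^p := by positivity
    have := mul_le_mul_of_nonneg_right hc hF
    have e2 : M+1+1-(M+1) = 1 := by omega
    simp only [e2, Nat.sub_zero, zero_add, Nat.factorial_one, Nat.cast_one, one_mul, mul_one]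
    linarith

lemma aux_desc (n j : ℕ) (hj : j ≤ n) :
    (n:ℝ)^j ≤ Real.exp 1 ^ j * (n.descFactorial j : ℝ) := by
  have h1 : n^j * j.factorial ≤ j^j * n.descFactorial j := by
    rw [← Nat.descFactorial_self j, Nat.descFactorial_eq_prod_range, Nat.descFactorial_eq_prod_range]
    have : ∀ a : ℕ, a^j = ∏ i ∈ Finset.range j, a := by intro a; simp
    rw [this n, this j, ← Finset.prod_mul_distrib, ← Finset.prod_mul_distrib]
    apply Finset.prod_le_prod'
    intro i hi
    have hi' := Finset.mem_range.mp hi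
    obtain ⟨a, rfl⟩ : ∃ a, j = i + a := ⟨j - i, by omega⟩
    obtain ⟨b, rfl⟩ : ∃ b, n = i + a + b := ⟨n - (i + a), by omega⟩
    rw [show i + a - i = a by omega, show i + a + b - i = a + b by omega]
    nlinarith
  have h2 := Real.pow_div_factorial_le_exp (j:ℝ) (by positivity) j
  rw [div_le_iff₀ (by positivity)] at h2
  have h3 : (n:ℝ)^j * (j.factorial:ℝ) ≤ (j:ℝ)^j * (n.descFactorial j:ℝ) := by exact_mod_cast h1
  have h4 : Real.exp 1 ^ j = Real.exp j := by rw [← Real.exp_nat_mul]; simp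
  rw [h4]
  have h5 : (0:ℝ) < j.factorial := by positivity
  refine le_of_mul_le_mul_right ?_ h5
  calc _ ≤ _ := h3
    _ ≤ (Real.exp j * j.factorial) * (n.descFactorial j:ℝ) := by gcongr
    _ = _ := by ring

/-- weight -/
noncomputable def wt (p i : ℕ) : ℝ := if i = 0 then 0 else (i.factorial : ℝ)^(p+1)

lemma wt_nonneg (p i : ℕ) : 0 ≤ wt p i := by unfold wt; split_ifs <;> positivity

/-- weighted count of functions -/
noncomputable def GG (p c : ℕ) (α : Type) [Fintype α] : ℝ :=
  ∑ f : α → Fin c, ∏ j, wt p (Fintype.card {a // f a = j})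

lemma GG_succ (p c : ℕ) (α : Type) [Fintype α] :
    GG p (c+1) α = ∑ t : Finset α, wt p t.card * GG p c {a // a ∉ t} := by
  unfold GG
  rw [← Finset.sum_fiberwise (s := Finset.univ)
    (g := fun f : α → Fin (c+1) => Finset.univ.filter (fun a => f a = 0))]
  refine Finset.sum_congr rfl fun t _ => ?_
  rw [Finset.mul_sum]
  symm
  refine Finset.sum_bij' 
    (i := fun (g : {a // a ∉ t} → Fin c) _ => fun a => if h : a ∈ t then 0 else (g ⟨a, h⟩).succ)
    (j := fun f hf => fun a => (f a.1).pred (by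
      have := (Finset.mem_filter.mp hf).2
      intro h0
      exact a.2 ((Finset.ext_iff.mp this a.1).mp (Finset.mem_filter.mpr ⟨Finset.mem_univ _, h0⟩)))) ?_ ?_ ?_ ?_ ?_
  · intro g _
    simp only [Finset.mem_filter, Finset.mem_univ, true_and]
    ext a
    by_cases h : a ∈ t <;> simp [h, Fin.succ_ne_zero]
  · intros; simp
  · intro g _
    funext a
    simp [a.2]
  · intro f hf
    have := (Finset.mem_filter.mp hf).2
    funext a
    by_cases h : a ∈ t
    · have h' := h
      rw [← this] at h'
      simp at h'
      simp [h, h']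
    · simp [h]
  · intro g _
    rw [Fin.prod_univ_succ]
    congr 1
    · congr 1
      rw [Fintype.card_subtype]
      congr 1
      ext a
      by_cases h : a ∈ t <;> simp [h, Fin.succ_ne_zero]
    · refine Finset.prod_congr rfl fun j _ => ?_
      congr 1
      refine Fintype.card_congr ⟨fun a => ⟨a.1.1, ?_⟩, fun a => ⟨⟨a.1, ?_⟩, ?_⟩, ?_, ?_⟩
      · have := a.2
        have h := a.1.2
        simp [h, this]
      · intro h
        have := a.2
        simp [h] at this
        exact Fin.succ_ne_zero _ this.symm
      · have h2 := a.2
        by_cases h : a.1 ∈ t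
        · simp [h] at h2
          exact absurd h2.symm (Fin.succ_ne_zero _)
        · simpa [h] using h2
      · intro a; rfl
      · intro a; rfl

lemma GG_bound (p : ℕ) (hp : 2 ≤ p) (c : ℕ) : ∀ (α : Type) [Fintype α],
    GG p (c+1) α ≤ if c < Fintype.card α then
      (5/2)^c * ((Fintype.card α).factorial : ℝ) * ((Fintype.card α - c).factorial : ℝ)^p else 0 := by
  induction c with
  | zero =>
    intro α _
    unfold GG
    have : ∀ f : α → Fin 1, Fintype.card {a // f a = 0} = Fintype.card α := by
      intro f
      apply Fintype.card_of_subtype Finset.univ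
      intro x; simp [Subsingleton.elim (f x) 0]
    simp [this, wt, Nat.pos_iff_ne_zero]
    split_ifs <;> simp [pow_succ, mul_comm]
  | succ c ih =>
    intro α _
    rw [GG_succ]
    set n := Fintype.card α with hn
    have hcard : ∀ t : Finset α, Fintype.card {a // a ∉ t} = n - t.card := by
      intro t; rw [hn, Fintype.card_subtype_compl]; simp
    calc _ ≤ ∑ t : Finset α, wt p t.card * (if c < n - t.card then
          (5/2)^c * ((n - t.card).factorial : ℝ) * ((n - t.card - c).factorial : ℝ)^p else 0) := by
          refine Finset.sum_le_sum fun t _ => mul_le_mul_of_nonneg_left ?_ (wt_nonneg _ _)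
          have := ih {a // a ∉ t}
          rw [hcard t] at this
          exact this
      _ = ∑ i ∈ Finset.range (n+1), (n.choose i) * (wt p i * (if c < n - i then
          (5/2)^c * ((n - i).factorial : ℝ) * ((n - i - c).factorial : ℝ)^p else 0)) := by
          have := Finset.sum_powerset_apply_card (fun i => wt p i * (if c < n - i then
            (5/2)^c * ((n - i).factorial : ℝ) * ((n - i - c).factorial : ℝ)^p else 0))
            (x := (Finset.univ : Finset α))
          simpa [nsmul_eq_mul, ← hn] using this
      _ ≤ _ := ?_
    rw [Finset.sum_range_succ']
    have h0 : wt p 0 = 0 := by simp [wt]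
    rw [h0, zero_mul, mul_zero, add_zero]
    split_ifs with hcn
    · obtain ⟨N, hN⟩ : ∃ N, n = N + (c+1) := ⟨n - (c+1), by omega⟩
      have hsub : Finset.range N ⊆ Finset.range n := by
        intro x; simp; omega
      rw [← Finset.sum_subset hsub]
      · have hU := aux_U p N hp
        have e : n - (c+1) = N := by omega
        rw [e]
        calc _ = ∑ i ∈ Finset.range N, ((5/2)^c * (n.factorial:ℝ)) *
              (((i+1).factorial : ℝ) * ((N-i).factorial : ℝ))^p := by
              refine Finset.sum_congr rfl fun i hi => ?_
              have hi' := Finset.mem_range.mp hi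
              rw [if_pos (by omega), show n - (i+1) - c = N - i by omega]
              have hch := Nat.choose_mul_factorial_mul_factorial (show i+1 ≤ n by omega)
              rw [← hch]
              simp only [wt, Nat.succ_ne_zero, if_false]
              push_cast
              ring
          _ ≤ _ := by
              rw [← Finset.mul_sum]
              calc _ ≤ ((5/2)^c * (n.factorial:ℝ)) * (5/2 * (N.factorial:ℝ)^p) := by gcongr
                _ = _ := by ring
      · intro i hi hi2
        simp at hi hi2
        rw [if_neg (by omega)]; simp
    · apply le_of_eq
      apply Finset.sum_eq_zero
      intro i hi
      rw [if_neg (by omega)]; simp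
lemma comp_le {n : ℕ} (k : ℕ) (π : Fin k → Equiv.Perm (Fin n)) : numComponents k π ≤ n := by
  unfold numComponents
  have := Nat.card_le_card_of_surjective
    (Quot.mk (fun a b : Fin n => ∃ i, π i a = b)) Quot.mk_surjective
  simpa using this

lemma comp_pos {n : ℕ} (hn : 0 < n) (k : ℕ) (π : Fin k → Equiv.Perm (Fin n)) :
    0 < numComponents k π := by
  unfold numComponents
  have : Nonempty (Quot (fun a b : Fin n => ∃ i, π i a = b)) := ⟨Quot.mk _ ⟨0, hn⟩⟩
  have : Finite (Quot (fun a b : Fin n => ∃ i, π i a = b)) :=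
    Finite.of_surjective _ Quot.mk_surjective
  exact Nat.card_pos

lemma fac_le_card {n : ℕ} (k : ℕ) (π : Fin k → Equiv.Perm (Fin n)) :
    (numComponents k π).factorial ≤
      (Finset.univ.filter (fun f : Fin n → Fin (numComponents k π) =>
        Function.Surjective f ∧ ∀ i, f ∘ (π i) = f)).card := by
  have : Finite (Quot (fun a b : Fin n => ∃ i, π i a = b)) :=
    Finite.of_surjective _ Quot.mk_surjective
  let _ : Fintype (Quot (fun a b : Fin n => ∃ i, π i a = b)) := Fintype.ofFinite _
  have hQ : Fintype.card (Quot (fun a b : Fin n => ∃ i, π i a = b)) = numComponents k π := by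
    unfold numComponents; rw [Nat.card_eq_fintype_card]
  have hE := Fintype.card_equiv (Fintype.equivFinOfCardEq hQ)
  rw [hQ] at hE
  rw [← hE, ← Finset.card_univ]
  refine Finset.card_le_card_of_injOn (fun e => fun a => e (Quot.mk _ a)) ?_ ?_
  · intro e _
    simp only [Finset.coe_filter, Finset.mem_univ, true_and, Set.mem_ofPred_eq]
    refine ⟨e.surjective.comp Quot.mk_surjective, fun i => ?_⟩
    funext a
    simp only [Function.comp]
    congr 1
    exact (Quot.sound ⟨i, rfl⟩).symm
  · intro e _ e' _ h
    ext q
    induction q using Quot.ind with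
    | mk a => exact congrArg Fin.val (congrFun h a)

lemma card_inv {n c : ℕ} (k : ℕ) (f : Fin n → Fin c) :
    (Finset.univ.filter (fun π : Fin k → Equiv.Perm (Fin n) => ∀ i, f ∘ (π i) = f)).card
      = (∏ j, (Fintype.card {a // f a = j}).factorial)^k := by
  have h : (Finset.univ.filter (fun π : Fin k → Equiv.Perm (Fin n) => ∀ i, f ∘ (π i) = f))
      = Fintype.piFinset (fun _ => Finset.univ.filter
        (fun g : Equiv.Perm (Fin n) => f ∘ g = f)) := by
    ext π; simp
  rw [h, Fintype.card_piFinset_const]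
  congr 1
  have := DomMulAct.stabilizer_card f
  rw [← Fintype.card_subtype]
  convert this

lemma count_le (n p c : ℕ) :
    (c.factorial : ℝ) * ((Finset.univ.filter
      (fun π : Fin (p+1) → Equiv.Perm (Fin n) => numComponents (p+1) π = c)).card : ℝ)
      ≤ GG p c (Fin n) := by
  have key : ∀ π : Fin (p+1) → Equiv.Perm (Fin n),
      (if numComponents (p+1) π = c then (c.factorial : ℝ) else 0) ≤
      ∑ f : Fin n → Fin c, if Function.Surjective f ∧ ∀ i, f ∘ (π i) = f then (1:ℝ) else 0 := by
    intro π
    split_ifs with h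
    · subst h
      rw [Finset.sum_boole]
      exact_mod_cast fac_le_card (p+1) π
    · exact Finset.sum_nonneg fun _ _ => by split_ifs <;> norm_num
  calc _ = ∑ π : Fin (p+1) → Equiv.Perm (Fin n),
        (if numComponents (p+1) π = c then (c.factorial : ℝ) else 0) := by
        rw [← Finset.sum_filter, Finset.sum_const, nsmul_eq_mul, mul_comm]
    _ ≤ ∑ π : Fin (p+1) → Equiv.Perm (Fin n), ∑ f : Fin n → Fin c,
        (if Function.Surjective f ∧ ∀ i, f ∘ (π i) = f then (1:ℝ) else 0) :=
        Finset.sum_le_sum fun π _ => key π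
    _ = ∑ f : Fin n → Fin c, ∑ π : Fin (p+1) → Equiv.Perm (Fin n),
        (if Function.Surjective f ∧ ∀ i, f ∘ (π i) = f then (1:ℝ) else 0) := Finset.sum_comm
    _ ≤ GG p c (Fin n) := by
        have hGG : GG p c (Fin n) =
            ∑ f : Fin n → Fin c, ∏ j, wt p (Fintype.card {a // f a = j}) := by
          unfold GG
          congr!
        rw [hGG]
        refine Finset.sum_le_sum fun f _ => ?_
        by_cases hf : Function.Surjective f
        · simp only [hf, true_and]
          rw [Finset.sum_boole, card_inv]
          push_cast
          rw [← Finset.prod_pow]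
          refine le_of_eq (Finset.prod_congr rfl fun j _ => ?_)
          have : Fintype.card {a // f a = j} ≠ 0 := by
            obtain ⟨a, ha⟩ := hf j
            have : Nonempty {a // f a = j} := ⟨⟨a, ha⟩⟩
            exact Fintype.card_ne_zero
          simp [wt, this]
        · simp only [hf, false_and, if_false, Finset.sum_const_zero]
          exact Finset.prod_nonneg fun _ _ => wt_nonneg _ _

/-- Tail bound for the probability of `d+1` components. -/
lemma prob_le (n p d : ℕ) (hp : 2 ≤ p) (hd : d < n) :
    ((Finset.univ.filter
      (fun π : Fin (p+1) → Equiv.Perm (Fin n) => numComponents (p+1) π = d+1)).card : ℝ)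
      / ((n.factorial : ℝ)^(p+1))
      ≤ (5/2)^d / ((d+1).factorial : ℝ) * (1 / (n.descFactorial d : ℝ)) ^ p := by
  have h1 := count_le n p (d+1)
  have h2 := GG_bound p hp d (Fin n)
  rw [Fintype.card_fin, if_pos hd] at h2
  have h3 := h1.trans h2
  have h4 : ((n-d).factorial : ℝ) * (n.descFactorial d : ℝ) = n.factorial := by
    exact_mod_cast Nat.factorial_mul_descFactorial hd.le
  have hD : (0:ℝ) < (n.descFactorial d : ℝ) := by
    exact_mod_cast Nat.descFactorial_pos.mpr hd.le
  have hF : (0:ℝ) < ((d+1).factorial : ℝ) := by positivity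
  have hN : (0:ℝ) < (n.factorial : ℝ) := by positivity
  rw [div_le_iff₀ (by positivity)]
  have h5 : (5/2:ℝ)^d / ((d+1).factorial : ℝ) * (1 / (n.descFactorial d : ℝ)) ^ p *
      (n.factorial : ℝ)^(p+1)
      = ((5/2)^d * (n.factorial : ℝ) * ((n-d).factorial : ℝ)^p) / ((d+1).factorial : ℝ) := by
    have h6 : ((n-d).factorial : ℝ) = n.factorial / (n.descFactorial d : ℝ) := by
      rw [eq_div_iff hD.ne', h4]
    rw [h6, div_pow, div_pow, one_pow, pow_succ]
    ring
  rw [h5, le_div_iff₀ hF, mul_comm]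
  exact h3

lemma geo_aux (d : ℕ) : (1/2:ℝ)^(d+1) * (5/2)^(d+2) / ((d+3).factorial : ℝ)
    ≤ 25/48 * (1/3)^d := by
  induction d with
  | zero => norm_num [Nat.factorial]
  | succ d ih =>
    have h : ((d+1+3).factorial : ℝ) = (d+4) * ((d+3).factorial : ℝ) := by
      have := Nat.factorial_succ (d+3)
      rw [show d+1+3 = d+3+1 by ring, this]; push_cast; ring
    rw [h]
    have hd : (0:ℝ) ≤ d := by positivity
    have e : (1/2:ℝ)^(d+1+1) * (5/2)^(d+1+2) / ((d+4) * ((d+3).factorial : ℝ))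
        = (5/4/((d:ℝ)+4)) * ((1/2:ℝ)^(d+1) * (5/2)^(d+2) / ((d+3).factorial : ℝ)) := by
      field_simp; ring
    rw [e]
    have h2 : 5/4/((d:ℝ)+4) ≤ 1/3 := by
      rw [div_le_iff₀ (by positivity)]; linarith
    calc _ ≤ (1/3) * (25/48 * (1/3:ℝ)^d) := by gcongr
      _ = _ := by ring

lemma geo_sum (M : ℕ) : ∑ d ∈ Finset.range M, (1/3:ℝ)^d ≤ 3/2 := by
  have : ∀ M : ℕ, ∑ d ∈ Finset.range M, (1/3:ℝ)^d = 3/2 * (1 - (1/3)^M) := by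
    intro M
    induction M with
    | zero => simp
    | succ M ih => rw [Finset.sum_range_succ, ih, pow_succ]; ring
  rw [this]
  have : (0:ℝ) ≤ (1/3)^M := by positivity
  linarith

/-- For `n ≥ 19`, `k ≥ 3` and `0 < m ≤ (1/2)·(n/e)^(k−1)`, a graph `G` drawn from
`R*(n, 2k)` satisfies `E[m^(C(G))] ≤ m + m²·(n/e)^(1−k)`. -/
theorem stmt15 (n k : ℕ) (m : ℝ) (hn : 19 ≤ n) (hk : 3 ≤ k) (hm : 0 < m)
    (hmn : m ≤ (1 / 2) * ((n : ℝ) / Real.exp 1) ^ (k - 1)) :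
    (∑ π : Fin k → Equiv.Perm (Fin n), m ^ numComponents k π) /
        (Fintype.card (Fin k → Equiv.Perm (Fin n)) : ℝ)
      ≤ m + m ^ 2 * ((n : ℝ) / Real.exp 1) ^ ((1 : ℤ) - (k : ℤ)) := by
  obtain ⟨p, rfl⟩ : ∃ p, k = p + 1 := ⟨k - 1, by omega⟩
  have hp : 2 ≤ p := by omega
  have hcardP : (Fintype.card (Fin (p+1) → Equiv.Perm (Fin n)) : ℝ) = (n.factorial : ℝ)^(p+1) := by
    rw [Fintype.card_fun, Fintype.card_perm]; simp
  have hn0 : (0:ℝ) < n := by exact_mod_cast (by omega : 0 < n)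
  have he := Real.exp_pos 1
  set r : ℝ := (n:ℝ) / Real.exp 1 with hr
  have hr0 : 0 < r := by positivity
  simp only [Nat.add_sub_cancel] at hmn
  have hz : r ^ ((1:ℤ) - ((p+1 : ℕ) : ℤ)) = (r^p)⁻¹ := by
    rw [show (1:ℤ) - ((p+1 : ℕ) : ℤ) = -(p:ℤ) by push_cast; ring, zpow_neg, zpow_natCast]
  rw [hz]
  set y : ℝ := r^p with hy
  have hy0 : 0 < y := by positivity
  have hmy : m * y⁻¹ ≤ 1/2 := by
    rw [← div_eq_mul_inv, div_le_iff₀ hy0]; exact hmn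
  set P : ℕ → ℝ := fun d => ((Finset.univ.filter
      (fun π : Fin (p+1) → Equiv.Perm (Fin n) => numComponents (p+1) π = d+1)).card : ℝ)
      / ((n.factorial : ℝ)^(p+1)) with hP
  have hsum : (∑ π : Fin (p+1) → Equiv.Perm (Fin n), m ^ numComponents (p+1) π) /
        (Fintype.card (Fin (p+1) → Equiv.Perm (Fin n)) : ℝ)
      = ∑ d ∈ Finset.range n, m^(d+1) * P d := by
    rw [hcardP]
    rw [← Finset.sum_fiberwise_of_maps_to (s := Finset.univ) (t := Finset.range n)
      (g := fun π : Fin (p+1) → Equiv.Perm (Fin n) => numComponents (p+1) π - 1)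
      (by
        intro π _
        have := comp_le (p+1) π
        have := comp_pos (by omega : 0 < n) (p+1) π
        simp only [Finset.mem_range]; omega), Finset.sum_div]
    refine Finset.sum_congr rfl fun d _ => ?_
    simp only [hP]
    rw [mul_div_assoc']
    congr 1
    have hfil : (Finset.univ.filter (fun π : Fin (p+1) → Equiv.Perm (Fin n) =>
        numComponents (p+1) π - 1 = d)) = (Finset.univ.filter
        (fun π : Fin (p+1) → Equiv.Perm (Fin n) => numComponents (p+1) π = d+1)) := by
      apply Finset.filter_congr
      intro π _
      have := comp_pos (by omega : 0 < n) (p+1) π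
      omega
    rw [hfil, mul_comm, ← nsmul_eq_mul, ← Finset.sum_const]
    exact Finset.sum_congr rfl fun π hπ => by rw [(Finset.mem_filter.mp hπ).2]
  rw [hsum]
  obtain ⟨M, rfl⟩ : ∃ M, n = M + 2 := ⟨n - 2, by omega⟩
  rw [Finset.sum_range_succ', Finset.sum_range_succ']
  have hP0 : P 0 ≤ 1 := by
    have := prob_le (M+2) p 0 hp (by omega)
    simpa using this
  have hP1 : P 1 ≤ 1/5 * y⁻¹ := by
    have h := prob_le (M+2) p 1 hp (by omega)
    refine h.trans ?_
    have e1 : (1 / (((M+2).descFactorial 1 : ℕ) : ℝ))^p = (1/Real.exp 1)^p * y⁻¹ := by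
      rw [hy, ← inv_pow, ← mul_pow, hr, Nat.descFactorial_one]
      congr 1
      field_simp
    rw [e1, ← mul_assoc]
    apply mul_le_mul_of_nonneg_right _ (by positivity)
    have h25 : 1/Real.exp 1 ≤ 2/5 := by
      rw [div_le_iff₀ he]
      have := Real.exp_one_gt_d9
      linarith
    have h0 : (1/Real.exp 1)^p ≤ (2/5)^2 :=
      calc _ ≤ (2/5:ℝ)^p := by gcongr
        _ ≤ _ := pow_le_pow_of_le_one (by norm_num) (by norm_num) hp
    norm_num [Nat.factorial] at h0 ⊢
    linarith
  have hPd : ∀ d ∈ Finset.range M, m^(d+1+1+1) * P (d+1+1) ≤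
      m^2 * y⁻¹ * (25/48 * (1/3)^d) := by
    intro d hd
    have hd' := Finset.mem_range.mp hd
    have h := prob_le (M+2) p (d+2) hp (by omega)
    have hD : (0:ℝ) < ((M+2).descFactorial (d+2) : ℝ) := by
      exact_mod_cast Nat.descFactorial_pos.mpr (by omega)
    have h2 : (1 / ((M+2).descFactorial (d+2) : ℝ))^p ≤ (y⁻¹)^(d+2) := by
      have h3 := aux_desc (M+2) (d+2) (by omega)
      have h4 : 1 / ((M+2).descFactorial (d+2) : ℝ) ≤ (r⁻¹)^(d+2) := by
        rw [hr, inv_div, div_pow, div_le_div_iff₀ hD (by positivity)]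
        linarith
      calc _ ≤ ((r⁻¹)^(d+2))^p := by gcongr
        _ = _ := by rw [hy, ← inv_pow, ← pow_mul, ← pow_mul, mul_comm]
    have hmy0 : 0 ≤ m * y⁻¹ := by positivity
    calc _ ≤ m^(d+3) * ((5/2)^(d+2) / ((d+3).factorial : ℝ) * (y⁻¹)^(d+2)) := by
          apply mul_le_mul_of_nonneg_left _ (by positivity)
          refine h.trans ?_
          apply mul_le_mul_of_nonneg_left h2 (by positivity)
      _ = m^2 * y⁻¹ * ((m*y⁻¹)^(d+1) * (5/2)^(d+2) / ((d+3).factorial : ℝ)) := by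
          rw [mul_pow]; ring
      _ ≤ m^2 * y⁻¹ * ((1/2)^(d+1) * (5/2)^(d+2) / ((d+3).factorial : ℝ)) := by gcongr
      _ ≤ _ := by
          apply mul_le_mul_of_nonneg_left (geo_aux d) (by positivity)
  have hS := Finset.sum_le_sum hPd
  rw [← Finset.mul_sum, ← Finset.mul_sum] at hS
  have hq : 0 ≤ m^2 * y⁻¹ := by positivity
  have hg : m^2 * y⁻¹ * (25/48 * ∑ d ∈ Finset.range M, (1/3:ℝ)^d) ≤ m^2 * y⁻¹ * (25/48 * (3/2)) := by
    have := geo_sum M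
    gcongr
  have h1 : m^(0+1+1) * P (0+1) ≤ m^2 * (1/5 * y⁻¹) := by
    simp only [zero_add]
    exact mul_le_mul_of_nonneg_left hP1 (by positivity)
  have h0 : m^(0+1) * P 0 ≤ m := by
    simp only [zero_add, pow_one]
    exact mul_le_of_le_one_right hm.le hP0
  nlinarith
end
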